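/- Suppose K ≤ t ≤ T and the principal runs the UCB algorithm; fix a realized history h_{t−1} and the strategies S^{(−i)} of all arms other than i. Then under arm coupling, for every assignment of true rewards and every strategy S^{(i)} of arm i, the number of pulls of arm i from time t to T satisfies n_i^{(LSI, S^{(−i)})}(t:T) ≥ n_i^{(S^{(i)}, S^{(−i)})}(t:T), i.e., arm i is pulled at least as many times under LSI as under S^{(i)}, with probability 1. -/

import Mathlib

open MeasureTheory ProbabilityTheory Real Finset

namespace StrategicBanditsCoupling

variable {K : ℕ}

/-- Cumulative manipulation of arm `j` after its first `n` pulls under the schedule `inv`,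
where `inv j s` is arm `j`'s manipulation at its `s`-th pull (under arm coupling, an adaptive
strategy of arm `j` reduces to such a schedule, since it only observes its own rewards). -/
def cumInv (inv : Fin K → ℕ → ℝ) (j : Fin K) (n : ℕ) : ℝ :=
  ∑ s ∈ Finset.Icc 1 n, inv j s

/-- The modified UCB index of arm `j`, when the current pull counts are `cnt`, the (coupled)
true reward of arm `k` at its `s`-th pull is `ρ k s`, and the manipulation schedules are
`inv`: empirical mean + confidence width `3σ√(ln T / n_j)` + `β_j / n_j`. -/
noncomputable def indexD (T : ℕ) (σ : ℝ) (ρ inv : Fin K → ℕ → ℝ)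
    (cnt : Fin K → ℕ) (j : Fin K) : ℝ :=
  (∑ s ∈ Finset.Icc 1 (cnt j), ρ j s) / (cnt j : ℝ)
    + 3 * σ * Real.sqrt (Real.log T / (cnt j : ℝ))
    + cumInv inv j (cnt j) / (cnt j : ℝ)

/-- The arm pulled by the UCB principal at the current round: an arm maximizing the modified
UCB index, ties broken by the fixed deterministic rule `tb`. -/
noncomputable def chosen (T : ℕ) (σ : ℝ) (ρ inv : Fin K → ℕ → ℝ)
    (tb : Finset (Fin K) → Fin K) (cnt : Fin K → ℕ) : Fin K :=
  tb (Finset.univ.filter fun j => ∀ k, indexD T σ ρ inv cnt k ≤ indexD T σ ρ inv cnt j)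

/-- The deterministic (arm-coupled) UCB dynamics of the pull counts: `cntSeq T σ ρ inv tb n0 m j`
is the number of pulls of arm `j` after `m` further UCB rounds, starting from the counts `n0`
determined by the fixed realized history. -/
noncomputable def cntSeq (T : ℕ) (σ : ℝ) (ρ inv : Fin K → ℕ → ℝ)
    (tb : Finset (Fin K) → Fin K) (n0 : Fin K → ℕ) : ℕ → Fin K → ℕ
  | 0 => n0
  | m + 1 => fun j =>
      if j = chosen T σ ρ inv tb (cntSeq T σ ρ inv tb n0 m)
      then cntSeq T σ ρ inv tb n0 m j + 1 else cntSeq T σ ρ inv tb n0 m j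

/-- The arm pulled at the `m`-th round after the fixed history (`m = 0` is time `t`). -/
noncomputable def pulledAt (T : ℕ) (σ : ℝ) (ρ inv : Fin K → ℕ → ℝ)
    (tb : Finset (Fin K) → Fin K) (n0 : Fin K → ℕ) (m : ℕ) : Fin K :=
  chosen T σ ρ inv tb (cntSeq T σ ρ inv tb n0 m)

/-- The schedule in which arm `i` keeps its historical manipulations (at its first `n0 i`
pulls), invests its entire remaining budget at its next — `(n0 i + 1)`-th — pull (the LSI
strategy from time `t` onwards), and nothing afterwards; every other arm keeps the schedule
`inv`. -/
def lsiSched (B : Fin K → ℝ) (i : Fin K) (inv : Fin K → ℕ → ℝ) (n0 : Fin K → ℕ) :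
    Fin K → ℕ → ℝ :=
  fun j s =>
    if j = i then
      if s ≤ n0 i then inv i s
      else if s = n0 i + 1 then B i - ∑ u ∈ Finset.Icc 1 (n0 i), |inv i u|
      else 0
    else inv j s


section Aux

noncomputable def auxIdx {K : ℕ} (T : ℕ) (σ : ℝ) (ρ inv : Fin K → ℕ → ℝ) (j : Fin K) (n : ℕ) : ℝ :=
  (∑ s ∈ Finset.Icc 1 n, ρ j s) / (n : ℝ)
    + 3 * σ * Real.sqrt (Real.log T / (n : ℝ)) + cumInv inv j n / (n : ℝ)

def auxJ {K : ℕ} (i : Fin K) (f : Fin K → ℕ → ℝ) (v : ℝ) (c : Fin K → ℕ) (j : Fin K) : ℝ :=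
  if j = i then v else f j (c j)

noncomputable def auxCh {K : ℕ} (tb : Finset (Fin K) → Fin K) (i : Fin K) (f : Fin K → ℕ → ℝ) (v : ℝ)
    (c : Fin K → ℕ) : Fin K :=
  tb (Finset.univ.filter fun j => ∀ k, auxJ i f v c k ≤ auxJ i f v c j)

def auxO {K : ℕ} (i : Fin K) (c : Fin K → ℕ) : Fin K → ℕ := fun j => if j = i then 0 else c j

noncomputable def auxGoes {K : ℕ} (tb : Finset (Fin K) → Fin K) (i : Fin K) (f : Fin K → ℕ → ℝ) (v : ℝ)
    (d : Fin K → ℕ) : ℕ → (Fin K → ℕ) → Prop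
  | 0, c => auxCh tb i f v c = i ∧ c = d
  | k + 1, c => auxCh tb i f v c ≠ i ∧ auxGoes tb i f v d k (c + Pi.single (auxCh tb i f v c) 1)

variable {K : ℕ} {tb : Finset (Fin K) → Fin K} {i : Fin K} {f : Fin K → ℕ → ℝ}

lemma auxCh_max (htb : ∀ s : Finset (Fin K), s.Nonempty → tb s ∈ s) (v : ℝ) (c : Fin K → ℕ)
    (k : Fin K) : auxJ i f v c k ≤ auxJ i f v c (auxCh tb i f v c) := by
  have hne : (Finset.univ.filter fun j => ∀ k, auxJ i f v c k ≤ auxJ i f v c j).Nonempty := by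
    obtain ⟨j, -, hj⟩ := Finset.exists_max_image Finset.univ (auxJ i f v c) ⟨i, Finset.mem_univ i⟩
    exact ⟨j, by simpa using hj⟩
  have := htb _ hne
  rw [Finset.mem_filter] at this
  exact this.2 k

lemma auxCh_of_lt (htb : ∀ s : Finset (Fin K), s.Nonempty → tb s ∈ s) {v w : ℝ} {c : Fin K → ℕ}
    (h : auxCh tb i f v c = i) (hvw : v < w) : auxCh tb i f w c = i := by
  by_contra hne
  have h1 := auxCh_max (f := f) (i := i) htb w c i
  have h2 := auxCh_max (f := f) (i := i) htb v c (auxCh tb i f w c)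
  rw [h] at h2
  simp only [auxJ, if_neg hne, if_true] at h1 h2
  linarith

lemma auxGoes_sum {v : ℝ} {d : Fin K → ℕ} : ∀ (k : ℕ) (c : Fin K → ℕ), auxGoes tb i f v d k c →
    ∑ j, d j = ∑ j, c j + k := by
  intro k
  induction k with
  | zero => rintro c ⟨-, rfl⟩; simp
  | succ k ih =>
    rintro c ⟨-, h⟩
    rw [ih _ h]
    simp [Finset.sum_add_distrib]
    omega

lemma auxCh_big (htb : ∀ s : Finset (Fin K), s.Nonempty → tb s ∈ s) {v : ℝ} {c : Fin K → ℕ}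
    {x : Fin K} (hx : x ≠ i) (hv : v < f x (c x)) :
    auxCh tb i f v c ≠ i ∧ v < f (auxCh tb i f v c) (c (auxCh tb i f v c)) := by
  have h := auxCh_max (f := f) (i := i) htb v c x
  have hne : auxCh tb i f v c ≠ i := by
    intro he
    rw [he] at h
    simp only [auxJ, if_neg hx, if_true] at h
    linarith
  refine ⟨hne, ?_⟩
  simp only [auxJ, if_neg hx, if_neg hne] at h
  linarith

lemma auxGoes_comm (htb : ∀ s : Finset (Fin K), s.Nonempty → tb s ∈ s) {v : ℝ} {d : Fin K → ℕ} :
    ∀ k : ℕ,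
    (∀ (c : Fin K → ℕ) (x : Fin K), x ≠ i → v < f x (c x) → auxGoes tb i f v d k c →
      ∃ l, k = l + 1 ∧ auxGoes tb i f v d l (c + Pi.single x 1)) ∧
    (∀ (c : Fin K → ℕ) (x : Fin K), x ≠ i → v < f x (c x) →
      auxGoes tb i f v d k (c + Pi.single x 1) → auxGoes tb i f v d (k + 1) c) := by
  intro k
  induction k using Nat.strong_induction_on with
  | _ k ih =>
    have F : ∀ (c : Fin K → ℕ) (x : Fin K), x ≠ i → v < f x (c x) → auxGoes tb i f v d k c →
      ∃ l, k = l + 1 ∧ auxGoes tb i f v d l (c + Pi.single x 1) := by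
      intro c x hx hv hg
      obtain ⟨hyi, hyv⟩ := auxCh_big (f := f) htb hx hv
      cases k with
      | zero => exact absurd hg.1 hyi
      | succ k =>
        refine ⟨k, rfl, ?_⟩
        have hg2 := hg.2
        generalize auxCh tb i f v c = y at *
        by_cases hxy : x = y
        · subst hxy; exact hg2
        · obtain ⟨l, rfl, hl⟩ := (ih k (by omega)).1 _ x hx (by simpa [hxy] using hv) hg2
          rw [add_right_comm] at hl
          exact (ih l (by omega)).2 _ y hyi (by simpa [Ne.symm hxy] using hyv) hl
    refine ⟨F, ?_⟩
    intro c x hx hv hg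
    obtain ⟨hyi, hyv⟩ := auxCh_big (f := f) htb hx hv
    refine ⟨hyi, ?_⟩
    generalize auxCh tb i f v c = y at *
    by_cases hxy : x = y
    · subst hxy; exact hg
    · obtain ⟨l, rfl, hl⟩ := F _ y hyi (by simpa [Ne.symm hxy] using hyv) hg
      rw [add_right_comm] at hl
      exact (ih l (by omega)).2 _ x hx (by simpa [hxy] using hv) hl

/-- One step of the process at level `w ≥ v` does not change the final state at level `v`. -/
lemma auxGoes_step (htb : ∀ s : Finset (Fin K), s.Nonempty → tb s ∈ s) {v w : ℝ} (hvw : v ≤ w)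
    {c d : Fin K → ℕ} (hne : auxCh tb i f w c ≠ i) :
    (∃ k, auxGoes tb i f v d k c) →
      (∃ k, auxGoes tb i f v d k (c + Pi.single (auxCh tb i f w c) 1)) := by
  rintro ⟨k, hk⟩
  rcases hvw.eq_or_lt with rfl | hlt
  · cases k with
    | zero => exact absurd hk.1 hne
    | succ k => exact ⟨k, hk.2⟩
  · have h1 := auxCh_max (f := f) (i := i) htb w c i
    simp only [auxJ, if_neg hne, if_true] at h1
    obtain ⟨l, -, hl⟩ := (auxGoes_comm htb k).1 c _ hne (hlt.trans_le h1) hk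
    exact ⟨l, hl⟩

lemma auxGoes_step' (htb : ∀ s : Finset (Fin K), s.Nonempty → tb s ∈ s) {v w : ℝ} (hvw : v ≤ w)
    {c d : Fin K → ℕ} (hne : auxCh tb i f w c ≠ i) :
    (∃ k, auxGoes tb i f v d k (c + Pi.single (auxCh tb i f w c) 1)) →
      (∃ k, auxGoes tb i f v d k c) := by
  rintro ⟨k, hk⟩
  rcases hvw.eq_or_lt with rfl | hlt
  · exact ⟨k + 1, hne, hk⟩
  · have h1 := auxCh_max (f := f) (i := i) htb w c i
    simp only [auxJ, if_neg hne, if_true] at h1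
    exact ⟨k + 1, (auxGoes_comm htb k).2 c _ hne (hlt.trans_le h1) hk⟩

/-- Abstract process. -/
structure AuxProc (tb : Finset (Fin K) → Fin K) (i : Fin K) (f : Fin K → ℕ → ℝ) (u : ℕ → ℝ)
    (A : ℕ → Fin K → ℕ) : Prop where
  step : ∀ m, A (m + 1) = A m + Pi.single (auxCh tb i f (u (A m i)) (auxO i (A m))) 1

lemma auxO_i (c : Fin K → ℕ) : auxO i (c + Pi.single i 1) = auxO i c := by
  funext j
  by_cases h : j = i <;> simp [auxO, h]

lemma auxO_ne (c : Fin K → ℕ) {x : Fin K} (hx : x ≠ i) :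
    auxO i (c + Pi.single x 1) = auxO i c + Pi.single x 1 := by
  funext j
  by_cases h : j = i
  · subst h; simp [auxO, hx.symm]
  · simp [auxO, h]

lemma auxProc_mono {u : ℕ → ℝ} {A : ℕ → Fin K → ℕ} (h : AuxProc tb i f u A) (m : ℕ) :
    A 0 i ≤ A m i := by
  induction m with
  | zero => exact le_rfl
  | succ m ih => rw [h.step]; simp only [Pi.add_apply]; omega

lemma auxProc_sum {u : ℕ → ℝ} {A : ℕ → Fin K → ℕ} (h : AuxProc tb i f u A) (m : ℕ) :
    ∑ j, A m j = ∑ j, A 0 j + m := by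
  induction m with
  | zero => simp
  | succ m ih => rw [h.step]; simp [Finset.sum_add_distrib, ih]; omega

lemma auxO_sum (c : Fin K → ℕ) : ∑ j, auxO i c j + c i = ∑ j, c j := by
  have : ∀ j, c j = auxO i c j + if j = i then c i else 0 := by
    intro j; by_cases h : j = i <;> simp [auxO, h]
  rw [Finset.sum_congr rfl (fun j _ => this j), Finset.sum_add_distrib]
  simp

lemma auxProc_inv (htb : ∀ s : Finset (Fin K), s.Nonempty → tb s ∈ s) {u : ℕ → ℝ}
    {A : ℕ → Fin K → ℕ} (h : AuxProc tb i f u A) (d : Fin K → ℕ) (v : ℝ) (m : ℕ) :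
    (∀ k, A 0 i ≤ k → k ≤ A m i → v ≤ u k) →
    ((∃ k, auxGoes tb i f v d k (auxO i (A 0))) ↔ (∃ k, auxGoes tb i f v d k (auxO i (A m)))) := by
  induction m with
  | zero => intro _; exact Iff.rfl
  | succ m ih =>
    intro hv
    have hle : A m i ≤ A (m + 1) i := by rw [h.step]; simp
    rw [ih (fun k h1 h2 => hv k h1 (h2.trans hle)), h.step]
    by_cases hc : auxCh tb i f (u (A m i)) (auxO i (A m)) = i
    · rw [hc, auxO_i]
    · rw [auxO_ne _ hc]
      have := hv _ (auxProc_mono h m) hle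
      exact ⟨auxGoes_step htb this hc, auxGoes_step' htb this hc⟩

lemma auxProc_inv2 (htb : ∀ s : Finset (Fin K), s.Nonempty → tb s ∈ s) {u : ℕ → ℝ}
    {A : ℕ → Fin K → ℕ} (h : AuxProc tb i f u A) (m : ℕ) :
    ∃ v, (∀ k, A 0 i ≤ k → k ≤ A m i → v ≤ u k) ∧
      (v = u (A m i) ∨ auxCh tb i f v (auxO i (A m)) = i) := by
  induction m with
  | zero =>
    refine ⟨u (A 0 i), fun k h1 h2 => ?_, Or.inl rfl⟩
    rw [le_antisymm h1 h2]
  | succ m ih =>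
    obtain ⟨v, hv, hor⟩ := ih
    by_cases hc : auxCh tb i f (u (A m i)) (auxO i (A m)) = i
    · have hs : auxCh tb i f v (auxO i (A m)) = i := by
        rcases hor with rfl | h'
        · exact hc
        · exact h'
      have hA := h.step m
      rw [hc] at hA
      have hi : A (m + 1) i = A m i + 1 := by rw [hA]; simp
      rcases le_total (u (A m i + 1)) v with hle | hle
      · refine ⟨u (A m i + 1), fun k h1 h2 => ?_, Or.inl (by rw [hi])⟩
        rcases (hi ▸ h2).eq_or_lt with rfl | hlt
        · exact le_rfl
        · exact hle.trans (hv k h1 (by omega))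
      · refine ⟨v, fun k h1 h2 => ?_, Or.inr (by rw [hA, auxO_i]; exact hs)⟩
        rcases (hi ▸ h2).eq_or_lt with rfl | hlt
        · exact hle
        · exact hv k h1 (by omega)
    · have hi : A (m + 1) i = A m i := by rw [h.step]; simp [Ne.symm hc]
      refine ⟨v, by rw [hi]; exact hv, Or.inl ?_⟩
      rw [hi]
      rcases hor with h' | h'
      · exact h'
      · by_contra hne
        exact hc (auxCh_of_lt htb h' (lt_of_le_of_ne (hv _ (auxProc_mono h m) le_rfl) hne))

lemma auxProc_dom (htb : ∀ s : Finset (Fin K), s.Nonempty → tb s ∈ s) {u u' : ℕ → ℝ}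
    {A A' : ℕ → Fin K → ℕ} (h : AuxProc tb i f u A) (h' : AuxProc tb i f u' A')
    (h0 : A 0 = A' 0) (N : ℕ)
    (huu : ∀ k, A 0 i ≤ k → k ≤ ∑ j, A 0 j + N → u k ≤ u' k) (m : ℕ) (hm : m ≤ N) :
    A m i ≤ A' m i := by
  induction m with
  | zero => rw [h0]
  | succ m ih =>
    have ih := ih (by omega)
    by_cases hc : auxCh tb i f (u (A m i)) (auxO i (A m)) = i
    · rw [h.step, h'.step, hc]
      rcases ih.eq_or_lt with he | hlt
      · obtain ⟨v, hv, hor⟩ := auxProc_inv2 htb h m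
        have hs : auxCh tb i f v (auxO i (A m)) = i := by
          rcases hor with rfl | h'
          · exact hc
          · exact h'
        have hbd : A m i ≤ ∑ j, A 0 j + N := by
          have h1 := auxProc_sum h m
          have h2 := Finset.single_le_sum (f := A m) (fun j _ => Nat.zero_le _) (Finset.mem_univ i)
          omega
        have g0 : ∃ k, auxGoes tb i f v (auxO i (A m)) k (auxO i (A 0)) :=
          (auxProc_inv htb h _ v m hv).2 ⟨0, hs, rfl⟩
        rw [h0] at g0
        obtain ⟨k, hk⟩ := (auxProc_inv htb h' _ v m (fun k h1 h2 => by
          rw [← h0] at h1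
          rw [← he] at h2
          exact (hv k h1 h2).trans (huu k h1 (h2.trans hbd)))).1 g0
        have e1 := auxGoes_sum _ _ hk
        have e2 := auxO_sum (i := i) (A m)
        have e3 := auxO_sum (i := i) (A' m)
        have e4 := auxProc_sum h m
        have e5 := auxProc_sum h' m
        rw [h0] at e4
        have hk0 : k = 0 := by omega
        subst hk0
        have hcc := hk.2
        have : auxCh tb i f (u' (A' m i)) (auxO i (A' m)) = i := by
          rw [hcc, ← he]
          rcases (huu _ (auxProc_mono h m) hbd).eq_or_lt with e | l
          · rw [← e]; exact hc
          · exact auxCh_of_lt htb hc l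
        rw [this]
        simp [he]
      · simp only [Pi.add_apply, Pi.single_eq_same]
        omega
    · have hi : A (m + 1) i = A m i := by rw [h.step]; simp [Ne.symm hc]
      rw [hi, h'.step]
      simp only [Pi.add_apply]
      omega

lemma auxProc_cnt (T : ℕ) (σ : ℝ) (ρ inv inv' : Fin K → ℕ → ℝ) (n0 : Fin K → ℕ)
    (hinv : ∀ j, j ≠ i → inv' j = inv j) :
    AuxProc tb i (auxIdx T σ ρ inv) (auxIdx T σ ρ inv' i) (cntSeq T σ ρ inv' tb n0) := by
  constructor
  intro m
  have key : ∀ cnt, chosen T σ ρ inv' tb cnt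
      = auxCh tb i (auxIdx T σ ρ inv) (auxIdx T σ ρ inv' i (cnt i)) (auxO i cnt) := by
    intro cnt
    have : indexD T σ ρ inv' cnt
        = auxJ i (auxIdx T σ ρ inv) (auxIdx T σ ρ inv' i (cnt i)) (auxO i cnt) := by
      funext j
      by_cases hj : j = i
      · subst hj; simp [auxJ, indexD, auxIdx]
      · simp [auxJ, indexD, auxIdx, auxO, hj, cumInv, hinv j hj]
    unfold chosen auxCh
    rw [this]
  rw [← key]
  funext j
  simp only [cntSeq, Pi.add_apply, Pi.single_apply]
  split_ifs <;> rfl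

lemma aux_cumInv (B : Fin K → ℝ) (inv : Fin K → ℕ → ℝ) (n0 : Fin K → ℕ) (T n : ℕ)
    (hb : ∑ s ∈ Finset.Icc 1 T, |inv i s| ≤ B i) (h1 : n0 i ≤ n) (h2 : n ≤ T) :
    cumInv inv i n ≤ cumInv (lsiSched B i inv n0) i n := by
  have hbase : cumInv (lsiSched B i inv n0) i (n0 i) = cumInv inv i (n0 i) := by
    unfold cumInv
    refine Finset.sum_congr rfl fun s hs => ?_
    simp [lsiSched, (Finset.mem_Icc.1 hs).2]
  have hstep : ∀ k, cumInv (lsiSched B i inv n0) i (n0 i + 1 + k)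
      = cumInv inv i (n0 i) + (B i - ∑ u ∈ Finset.Icc 1 (n0 i), |inv i u|) := by
    intro k
    induction k with
    | zero =>
      rw [← hbase]
      simp [cumInv, Finset.sum_Icc_succ_top, lsiSched]
    | succ k ih =>
      rw [← ih]
      unfold cumInv
      rw [← add_assoc, Finset.sum_Icc_succ_top (by omega)]
      have e1 : ¬ (n0 i + 1 + k + 1 ≤ n0 i) := by omega
      have e2 : ¬ (n0 i + 1 + k + 1 = n0 i + 1) := by omega
      simp [lsiSched, e1]
      omega
  rcases h1.eq_or_lt with rfl | hlt
  · rw [hbase]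
  · obtain ⟨k, rfl⟩ := Nat.exists_eq_add_of_le (Nat.succ_le_of_lt hlt)
    rw [Nat.succ_eq_add_one, hstep k]
    have hd : ∀ q, cumInv inv i (n0 i + q) - cumInv inv i (n0 i)
        ≤ ∑ u ∈ Finset.Icc 1 (n0 i + q), |inv i u| - ∑ u ∈ Finset.Icc 1 (n0 i), |inv i u| := by
      intro q
      induction q with
      | zero => simp
      | succ q ih =>
        unfold cumInv at *
        rw [← add_assoc, Finset.sum_Icc_succ_top (by omega), Finset.sum_Icc_succ_top (by omega)]
        have := le_abs_self (inv i (n0 i + q + 1))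
        linarith
    have h3 := hd (1 + k)
    rw [← add_assoc] at h3
    have h4 : ∑ u ∈ Finset.Icc 1 (n0 i + 1 + k), |inv i u| ≤ ∑ u ∈ Finset.Icc 1 T, |inv i u| :=
      Finset.sum_le_sum_of_subset_of_nonneg (Finset.Icc_subset_Icc_right h2)
        (fun _ _ _ => abs_nonneg _)
    linarith

end Aux

/-- **Lemma A.4, LSI pointwise dominates any strategy under arm coupling.**
Under arm coupling and UCB, fixing the history `h_{t−1}` (summarized by the counts `n0`) and
the strategies of the other arms, for every reward assignment `ρ` and every schedule `inv`
(arm `i`'s strategy `S^{(i)}` together with the others' strategies `S^{(−i)}`), arm `i` is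
pulled from time `t` to `T` at least as many times when it plays LSI as under `S^{(i)}`,
with probability 1. -/
theorem lsi_pointwise_dominance
    {K : ℕ} (T t : ℕ) (σ : ℝ) (B : Fin K → ℝ) (tb : Finset (Fin K) → Fin K)
    (hK : 2 ≤ K) (hσ : 0 < σ)
    (htb : ∀ s : Finset (Fin K), s.Nonempty → tb s ∈ s)
    (hB : ∀ j, 0 ≤ B j)
    (hKt : K ≤ t) (htT : t ≤ T)
    (n0 : Fin K → ℕ) (hn0 : ∀ j, 1 ≤ n0 j) (hn0sum : ∑ j, n0 j = t - 1)
    (i : Fin K) (ρ : Fin K → ℕ → ℝ) (inv : Fin K → ℕ → ℝ)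
    (hbudget : ∀ j, ∑ s ∈ Finset.Icc 1 T, |inv j s| ≤ B j) :
    cntSeq T σ ρ inv tb n0 (T - t + 1) i
      ≤ cntSeq T σ ρ (lsiSched B i inv n0) tb n0 (T - t + 1) i := by
  have hA := auxProc_cnt (tb := tb) (i := i) T σ ρ inv inv n0 (fun _ _ => rfl)
  have hA' := auxProc_cnt (tb := tb) (i := i) T σ ρ inv (lsiSched B i inv n0) n0
    (fun j hj => by funext s; simp [lsiSched, hj])
  refine auxProc_dom htb hA hA' rfl (T - t + 1) ?_ _ le_rfl
  intro k h1 h2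
  have h1' : n0 i ≤ k := h1
  have h2' : k ≤ ∑ j, n0 j + (T - t + 1) := h2
  have hkT : k ≤ T := by omega
  have := aux_cumInv B inv n0 T k (hbudget i) h1' hkT
  unfold auxIdx
  gcongr

end StrategicBanditsCoupling
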